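/- arXiv:2412.00655 — 2 statements merged into one kernel-verified Lean document; each statement's English description precedes it below -/
import Mathlib

section
/- Let 𝒳 = L^+, n ∈ ℕ, α_1,…,α_n ∈ (1,∞), h_i(x) = x^{α_i} for x ∈ [0,1], and let X be the constant random variable 1. Then □_{i=1}^n ρ_{h_i}(1) = ⊟_{i=1}^n ρ_{h_i}(1) = (□_{i=1}^n h_i)(1), and for any n-composition (A_1,…,A_n) ∈ Π_n satisfying Σ_{i=1}^n (P(A_i))^{α_i} = (□_{i=1}^n h_i)(1), the counter-monotonic allocation X_i = 1_{A_i}, i = 1,…,n, attains this infimum: Σ_{i=1}^n ρ_{h_i}(1_{A_i}) = □_{i=1}^n ρ_{h_i}(1). -/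
open MeasureTheory ProbabilityTheory Set

noncomputable section

variable {Ω : Type*} [MeasurableSpace Ω]

/-- An atomless measure: every set of positive measure has a measurable subset of
strictly smaller positive measure. -/
def Atomless (P : Measure Ω) : Prop :=
  ∀ A : Set Ω, MeasurableSet A → 0 < P A →
    ∃ B, B ⊆ A ∧ MeasurableSet B ∧ 0 < P B ∧ P B < P A

/-- Membership in the class `H` of distortion functions: increasing on `[0,1]`,
`h 0 = 0` and `h 1 = 1`. -/
def MemH (h : ℝ → ℝ) : Prop :=
  MonotoneOn h (Icc 0 1) ∧ h 0 = 0 ∧ h 1 = 1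

/-- Two random variables are counter-monotonic. -/
def CounterMonotone (P : Measure Ω) (X Y : Ω → ℝ) : Prop :=
  ∀ᵐ p ∂(P.prod P), (X p.1 - X p.2) * (Y p.1 - Y p.2) ≤ 0

/-- Two random variables are comonotonic. -/
def Comonotone (P : Measure Ω) (X Y : Ω → ℝ) : Prop :=
  ∀ᵐ p ∂(P.prod P), 0 ≤ (X p.1 - X p.2) * (Y p.1 - Y p.2)

/-- A random vector is pairwise counter-monotonic. -/
def PairwiseCtr (P : Measure Ω) {n : ℕ} (Xs : Fin n → Ω → ℝ) : Prop :=
  ∀ i j, i ≠ j → CounterMonotone P (Xs i) (Xs j)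

/-- A random vector is (pairwise) comonotonic. -/
def PairwiseCom (P : Measure Ω) {n : ℕ} (Xs : Fin n → Ω → ℝ) : Prop :=
  ∀ i j, i ≠ j → Comonotone P (Xs i) (Xs j)

/-- An `n`-composition of `Ω`: pairwise disjoint measurable sets whose union is `Ω`. -/
def IsComposition {n : ℕ} (A : Fin n → Set Ω) : Prop :=
  (∀ i, MeasurableSet (A i)) ∧ (∀ i j, i ≠ j → A i ∩ A j = ∅) ∧ (⋃ i, A i) = univ

/-- Nonnegative bounded measurable random variables (`L^+`). -/
def MemLpos (X : Ω → ℝ) : Prop :=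
  Measurable X ∧ (∀ ω, 0 ≤ X ω) ∧ ∃ M : ℝ, ∀ ω, X ω ≤ M

/-- The distortion riskmetric of a nonnegative random variable:
`ρ_g(X) = ∫_0^∞ g(P(X ≥ x)) dx`. -/
def distortionPos (P : Measure Ω) (g : ℝ → ℝ) (X : Ω → ℝ) : ℝ :=
  ∫ x in Ioi (0:ℝ), g ((P {ω | x ≤ X ω}).toReal)

/-- `Xs` is an allocation of `X` within `L^+`. -/
def IsAllocPos (P : Measure Ω) {n : ℕ} (X : Ω → ℝ) (Xs : Fin n → Ω → ℝ) : Prop :=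
  (∀ i, MemLpos (Xs i)) ∧ (∀ᵐ ω ∂P, ∑ i, Xs i ω = X ω)

/-- The inf-convolution `□_{i=1}^n ρ_{h_i}(X)` over allocations in `L^+`. -/
def infConvPos (P : Measure Ω) {n : ℕ} (h : Fin n → ℝ → ℝ) (X : Ω → ℝ) : EReal :=
  sInf {y : EReal | ∃ Xs : Fin n → Ω → ℝ, IsAllocPos P X Xs ∧
    y = ((∑ i, distortionPos P (h i) (Xs i) : ℝ) : EReal)}

/-- The counter-monotonic inf-convolution `⊟_{i=1}^n ρ_{h_i}(X)` over allocations in `L^+`. -/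
def ctrInfConvPos (P : Measure Ω) {n : ℕ} (h : Fin n → ℝ → ℝ) (X : Ω → ℝ) : EReal :=
  sInf {y : EReal | ∃ Xs : Fin n → Ω → ℝ, IsAllocPos P X Xs ∧ PairwiseCtr P Xs ∧
    y = ((∑ i, distortionPos P (h i) (Xs i) : ℝ) : EReal)}

/-- The inf-convolution of functions `h_1, …, h_n` on `[0,1]`:
`(□ h_i)(x) = inf { Σ h_i(x_i) : x_i ∈ [0,1], Σ x_i = x }`. -/
def funInfConv {n : ℕ} (h : Fin n → ℝ → ℝ) (x : ℝ) : ℝ :=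
  sInf {y : ℝ | ∃ t : Fin n → ℝ, (∀ i, t i ∈ Icc (0:ℝ) 1) ∧ (∑ i, t i) = x ∧
    y = ∑ i, h i (t i)}

/-- In an atomless space every set of positive measure has a subset of at most half its measure
which is still of positive measure. -/
lemma Atomless.exists_half {P : Measure Ω} [IsFiniteMeasure P] (hP : Atomless P) {A : Set Ω}
    (hA : MeasurableSet A) (hpos : 0 < P.real A) :
    ∃ B, B ⊆ A ∧ MeasurableSet B ∧ 0 < P.real B ∧ P.real B ≤ P.real A / 2 := by
  obtain ⟨B, hBA, hB, hB0, hBlt⟩ := hP A hA (by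
    rw [measureReal_def, ENNReal.toReal_pos_iff] at hpos
    exact hpos.1)
  have hB0' : 0 < P.real B := ENNReal.toReal_pos hB0.ne' (measure_ne_top P B)
  have hBlt' : P.real B < P.real A := (ENNReal.toReal_lt_toReal (measure_ne_top P B)
    (measure_ne_top P A)).2 hBlt
  have hdiff : P.real (A \ B) = P.real A - P.real B := measureReal_sdiff hBA hB
  rcases le_total (P.real B) (P.real A / 2) with hle | hle
  · exact ⟨B, hBA, hB, hB0', hle⟩
  · exact ⟨A \ B, sdiff_subset, hA.diff hB, by linarith, by linarith⟩

/-- In an atomless space every set of positive measure has subsets of arbitrarily small positive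
measure. -/
lemma Atomless.exists_small {P : Measure Ω} [IsFiniteMeasure P] (hP : Atomless P) {A : Set Ω}
    (hA : MeasurableSet A) (hpos : 0 < P.real A) {ε : ℝ} (hε : 0 < ε) :
    ∃ B, B ⊆ A ∧ MeasurableSet B ∧ 0 < P.real B ∧ P.real B < ε := by
  have key : ∀ k : ℕ, ∃ B, B ⊆ A ∧ MeasurableSet B ∧ 0 < P.real B ∧
      P.real B ≤ P.real A * (1 / 2) ^ k := by
    intro k
    induction k with
    | zero => exact ⟨A, subset_rfl, hA, hpos, by simp⟩
    | succ k ih =>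
      obtain ⟨B, hBA, hB, hB0, hBle⟩ := ih
      obtain ⟨C, hCB, hC, hC0, hCle⟩ := hP.exists_half hB hB0
      exact ⟨C, hCB.trans hBA, hC, hC0, by rw [pow_succ]; linarith⟩
  obtain ⟨k, hk⟩ := exists_pow_lt_of_lt_one (div_pos hε hpos) (by norm_num : (1 / 2 : ℝ) < 1)
  obtain ⟨B, hBA, hB, hB0, hBle⟩ := key k
  refine ⟨B, hBA, hB, hB0, hBle.trans_lt ?_⟩
  rw [lt_div_iff₀ hpos] at hk
  linarith

/-- One step of an exhaustion: a set `C ⊆ A` of measure at most `c` can be enlarged, within these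
constraints, by at least half of what any admissible enlargement achieves. -/
lemma exists_greedy_enlargement (P : Measure Ω) [IsFiniteMeasure P] {A C : Set Ω} {c : ℝ}
    (hC : MeasurableSet C) (hCA : C ⊆ A) (hCc : P.real C ≤ c) :
    ∃ E, (MeasurableSet E ∧ E ⊆ A ∧ P.real E ≤ c) ∧ C ⊆ E ∧
      ∀ D, MeasurableSet D → D ⊆ A \ C → P.real C + P.real D ≤ c →
        P.real D ≤ 2 * (P.real E - P.real C) := by
  set S : Set ℝ := {r | ∃ D, MeasurableSet D ∧ D ⊆ A \ C ∧ P.real C + P.real D ≤ c ∧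
    P.real D = r}
  have hbdd : BddAbove S := ⟨c - P.real C, by rintro _ ⟨D, _, _, h, rfl⟩; linarith⟩
  have h0 : (0 : ℝ) ∈ S := ⟨∅, .empty, empty_subset _, by simpa using hCc, by simp⟩
  have hnear : ∃ r ∈ S, sSup S ≤ 2 * r := by
    rcases (le_csSup hbdd h0).eq_or_lt with h | h
    · exact ⟨0, h0, by linarith⟩
    · obtain ⟨r, hr, hlt⟩ := exists_lt_of_lt_csSup ⟨0, h0⟩ (half_lt_self h)
      exact ⟨r, hr, by linarith⟩
  obtain ⟨_, ⟨D, hD, hDA, hDc, rfl⟩, hsup⟩ := hnear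
  have hunion : P.real (C ∪ D) = P.real C + P.real D :=
    measureReal_union (disjoint_sdiff_right.mono_right hDA) hD
  refine ⟨C ∪ D, ⟨hC.union hD, union_subset hCA (hDA.trans sdiff_subset), by linarith⟩,
    subset_union_left, fun D' hD' hDA' hDc' => ?_⟩
  have := le_csSup hbdd (show P.real D' ∈ S from ⟨D', hD', hDA', hDc', rfl⟩)
  linarith

/-- Sierpiński's theorem: an atomless finite measure takes every intermediate value. -/
lemma Atomless.exists_subset_measureReal_eq {P : Measure Ω} [IsFiniteMeasure P] (hP : Atomless P)
    {A : Set Ω} (hA : MeasurableSet A) {c : ℝ} (hc0 : 0 ≤ c) (hcA : c ≤ P.real A) :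
    ∃ B, B ⊆ A ∧ MeasurableSet B ∧ P.real B = c := by
  let T := {C : Set Ω // MeasurableSet C ∧ C ⊆ A ∧ P.real C ≤ c}
  have hstep : ∀ C : T, ∃ E : T, C.1 ⊆ E.1 ∧
      ∀ D, MeasurableSet D → D ⊆ A \ C.1 → P.real C.1 + P.real D ≤ c →
        P.real D ≤ 2 * (P.real E.1 - P.real C.1) := by
    rintro ⟨C, hC, hCA, hCc⟩
    obtain ⟨E, hE, h⟩ := exists_greedy_enlargement P hC hCA hCc
    exact ⟨⟨E, hE⟩, h⟩
  choose f hsub hgreedy using hstep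
  let B : ℕ → T := fun k => f^[k] ⟨∅, .empty, empty_subset _, by simpa using hc0⟩
  have hBs : ∀ k, B (k + 1) = f (B k) := fun k => Function.iterate_succ_apply' f k _
  have hmono : Monotone fun k => (B k).1 :=
    monotone_nat_of_le_succ fun k => by rw [hBs]; exact hsub _
  have hUm : MeasurableSet (⋃ k, (B k).1) := .iUnion fun k => (B k).2.1
  have hUA : (⋃ k, (B k).1) ⊆ A := iUnion_subset fun k => (B k).2.2.1
  have hlim : Filter.Tendsto (fun k => P.real (B k).1) Filter.atTop
      (nhds (P.real (⋃ k, (B k).1))) :=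
    (ENNReal.tendsto_toReal (measure_ne_top P _)).comp (tendsto_measure_iUnion_atTop hmono)
  have hUc : P.real (⋃ k, (B k).1) ≤ c := le_of_tendsto' hlim fun k => (B k).2.2.2
  refine ⟨_, hUA, hUm, hUc.antisymm (not_lt.1 fun hlt => ?_)⟩
  have hdiff : 0 < P.real (A \ ⋃ k, (B k).1) := by
    rw [measureReal_sdiff hUA hUm]; linarith
  obtain ⟨D, hDA, hD, hD0, hDlt⟩ := hP.exists_small (hA.diff hUm) hdiff (sub_pos.2 hlt)
  have hbound : ∀ k, P.real D ≤ 2 * (P.real (B (k + 1)).1 - P.real (B k).1) := fun k => by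
    rw [hBs]
    refine hgreedy (B k) D hD
      (hDA.trans (sdiff_subset_sdiff_right (subset_iUnion (fun k => (B k).1) k))) ?_
    have : P.real (B k).1 ≤ P.real (⋃ k, (B k).1) :=
      measureReal_mono (subset_iUnion (fun k => (B k).1) k)
    linarith
  have hzero := (((Filter.tendsto_add_atTop_iff_nat 1).2 hlim).sub hlim).const_mul 2
  have := ge_of_tendsto' hzero hbound
  linarith

/-- A measurable set in an atomless space splits into pieces of prescribed measures. -/
lemma Atomless.exists_partition {P : Measure Ω} [IsFiniteMeasure P] (hP : Atomless P) {m : ℕ}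
    (t : Fin (m + 1) → ℝ) (ht : ∀ i, 0 ≤ t i) {E : Set Ω} (hE : MeasurableSet E)
    (hsum : ∑ i, t i = P.real E) :
    ∃ A : Fin (m + 1) → Set Ω, (∀ i, MeasurableSet (A i)) ∧
      (∀ i j, i ≠ j → A i ∩ A j = ∅) ∧ (⋃ i, A i) = E ∧ ∀ i, P.real (A i) = t i := by
  induction m generalizing E with
  | zero =>
    refine ⟨fun _ => E, fun _ => hE, fun i j hij => (hij (Fin.ext (by omega))).elim,
      iUnion_const E, fun i => ?_⟩
    have hi : i = 0 := Fin.ext (by omega)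
    rw [← hsum, hi]
    exact Fin.sum_univ_one t
  | succ m ih =>
    rw [Fin.sum_univ_succ] at hsum
    have hrest : 0 ≤ ∑ i : Fin (m + 1), t i.succ := Finset.sum_nonneg fun i _ => ht _
    obtain ⟨B, hBE, hB, hBt⟩ := hP.exists_subset_measureReal_eq hE (ht 0) (by linarith)
    obtain ⟨A, hAm, hAd, hAu, hAt⟩ := ih (fun i => t i.succ) (fun i => ht _) (hE.diff hB)
      (by rw [measureReal_sdiff hBE hB]; linarith)
    have hBA : ∀ i, B ∩ A i = ∅ := fun i =>
      disjoint_iff_inter_eq_empty.1 (disjoint_sdiff_right.mono_right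
        (hAu ▸ subset_iUnion A i))
    refine ⟨Fin.cons B A, Fin.cases hB hAm, ?_, ?_, Fin.cases hBt hAt⟩
    · intro i j hij
      cases i using Fin.cases with
      | zero =>
        cases j using Fin.cases with
        | zero => exact (hij rfl).elim
        | succ j => simpa using hBA j
      | succ i =>
        cases j using Fin.cases with
        | zero => simpa [inter_comm] using hBA i
        | succ j => simpa using hAd i j (fun h => hij (congrArg _ h))
    · have : (⋃ i, (Fin.cons B A : Fin (m + 2) → Set Ω) i) = B ∪ ⋃ i, A i := by
        ext ω
        simp [Fin.exists_fin_succ]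
      rw [this, hAu, union_sdiff_cancel hBE]

lemma distortionPos_indicator_one (P : Measure Ω) {g : ℝ → ℝ} (hg : g 0 = 0) (A : Set Ω) :
    distortionPos P g (A.indicator fun _ => (1 : ℝ)) = g (P A).toReal := by
  have hcongr : ∀ x ∈ Ioi (0 : ℝ),
      g (P {ω | x ≤ A.indicator (fun _ => (1 : ℝ)) ω}).toReal =
        (Ioc (0 : ℝ) 1).indicator (fun _ => g (P A).toReal) x := by
    intro x hx
    rcases le_or_gt x 1 with h1 | h1
    · have : {ω | x ≤ A.indicator (fun _ => (1 : ℝ)) ω} = A := by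
        ext ω
        by_cases hω : ω ∈ A
        · simpa [hω] using h1
        · simpa [hω] using hx
      rw [this, indicator_of_mem (show x ∈ Ioc (0 : ℝ) 1 from ⟨hx, h1⟩)]
    · have : {ω | x ≤ A.indicator (fun _ => (1 : ℝ)) ω} = ∅ := by
        ext ω
        by_cases hω : ω ∈ A
        · simpa [hω] using h1
        · simpa [hω] using hx
      rw [this, indicator_of_notMem (fun h : x ∈ Ioc (0 : ℝ) 1 => h1.not_ge h.2)]
      simpa using hg
  rw [distortionPos, setIntegral_congr_fun measurableSet_Ioi hcongr,
    setIntegral_indicator measurableSet_Ioc, inter_eq_right.2 fun x hx => hx.1]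
  simp

lemma memLpos_indicator_one {A : Set Ω} (hA : MeasurableSet A) :
    MemLpos (A.indicator fun _ => (1 : ℝ)) :=
  ⟨measurable_const.indicator hA, fun _ => indicator_nonneg (fun _ _ => zero_le_one) _,
    1, fun _ => indicator_le_self' (fun _ _ => zero_le_one) _⟩

lemma counterMonotone_indicator_one (P : Measure Ω) {A B : Set Ω} (hAB : A ∩ B = ∅) :
    CounterMonotone P (A.indicator fun _ => (1 : ℝ)) (B.indicator fun _ => (1 : ℝ)) := by
  have hdisj : ∀ ω ∈ A, ω ∉ B := fun ω hA hB => (hAB ▸ ⟨hA, hB⟩ : ω ∈ (∅ : Set Ω))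
  refine .of_forall fun p => ?_
  by_cases h1 : p.1 ∈ A <;> by_cases h2 : p.2 ∈ A <;> by_cases h3 : p.1 ∈ B <;>
    by_cases h4 : p.2 ∈ B <;> simp_all

lemma IsComposition.isAllocPos_indicator {n : ℕ} {A : Fin n → Set Ω} (hA : IsComposition A)
    (P : Measure Ω) :
    IsAllocPos P (fun _ => (1 : ℝ)) fun i => (A i).indicator fun _ => (1 : ℝ) := by
  refine ⟨fun i => memLpos_indicator_one (hA.1 i), .of_forall fun ω => ?_⟩
  obtain ⟨i, hi⟩ := mem_iUnion.1 (hA.2.2 ▸ mem_univ ω : ω ∈ ⋃ i, A i)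
  rw [Finset.sum_eq_single_of_mem i (Finset.mem_univ i)]
  · exact indicator_of_mem hi _
  exact fun j _ hj => indicator_of_notMem
    (fun hj' => (hA.2.1 j i hj ▸ ⟨hj', hi⟩ : ω ∈ (∅ : Set Ω))) _

/-- Jensen's inequality for power distortions of risks with values in `[0,1]`. -/
lemma rpow_integral_le_distortionPos (P : Measure Ω) [IsProbabilityMeasure P] {X : Ω → ℝ}
    (hX : MemLpos X) (hX1 : ∀ᵐ ω ∂P, X ω ≤ 1) {a : ℝ} (ha : 1 ≤ a) :
    (∫ ω, X ω ∂P) ^ a ≤ distortionPos P (fun x => x ^ a) X := by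
  have ha0 : 0 < a := zero_lt_one.trans_le ha
  set f : ℝ → ℝ := fun x => P.real {ω | x ≤ X ω} with hf
  have hanti : Antitone f := fun x y hxy => measureReal_mono fun ω hω => hxy.trans hω
  have hf0 : ∀ x, 0 ≤ f x := fun x => measureReal_nonneg
  have hf1 : ∀ x, f x ≤ 1 := fun x => measureReal_le_one
  have hzero : ∀ x, 1 < x → f x = 0 := fun x hx => by
    have : P {ω | x ≤ X ω} = 0 :=
      measure_mono_null (fun ω hω => (hx.trans_le hω).not_ge) (ae_iff.1 hX1)
    simp [hf, measureReal_def, this]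
  have hXint : Integrable X P := by
    obtain ⟨M, hM⟩ := hX.2.2
    exact .of_bound hX.1.aestronglyMeasurable M
      (.of_forall fun ω => by rw [Real.norm_of_nonneg (hX.2.1 ω)]; exact hM ω)
  have hrestrict : ∀ g : ℝ → ℝ, (∀ x, 1 < x → g x = 0) →
      ∫ x in Ioi (0 : ℝ), g x = ∫ x in Ioc (0 : ℝ) 1, g x := fun g hg =>
    setIntegral_eq_of_subset_of_forall_sdiff_eq_zero measurableSet_Ioi (fun x hx => hx.1)
      fun x hx => hg x (not_le.1 fun h => hx.2 ⟨hx.1, h⟩)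
  have hmean : ∫ ω, X ω ∂P = ∫ x in Ioc (0 : ℝ) 1, f x := by
    rw [hXint.integral_eq_integral_meas_le (.of_forall hX.2.1)]
    exact hrestrict f hzero
  have hdist : distortionPos P (fun x => x ^ a) X = ∫ x in Ioc (0 : ℝ) 1, f x ^ a :=
    hrestrict (fun x => f x ^ a) fun x hx => by
      simp only [hzero x hx, Real.zero_rpow ha0.ne']
  have : IsProbabilityMeasure (volume.restrict (Ioc (0 : ℝ) 1)) := ⟨by simp⟩
  rw [hmean, hdist]
  refine (convexOn_rpow ha).map_integral_le
    (Real.continuous_rpow_const ha0.le).continuousOn isClosed_Ici (.of_forall hf0) ?_ ?_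
  · exact .of_bound hanti.measurable.aestronglyMeasurable 1
      (.of_forall fun x => by rw [Real.norm_of_nonneg (hf0 x)]; exact hf1 x)
  · refine .of_bound (hanti.measurable.pow_const a).aestronglyMeasurable 1 (.of_forall fun x => ?_)
    rw [Function.comp_apply, Real.norm_of_nonneg (Real.rpow_nonneg (hf0 x) a)]
    exact Real.rpow_le_one (hf0 x) (hf1 x) ha0.le

/-- Proposition 3 (i). For power distortion functions `h_i(x) = x^{α_i}`
with `α_i > 1` and the constant risk `X = 1` on `L^+`:
`□ ρ_{h_i}(1) = ⊟ ρ_{h_i}(1) = (□ h_i)(1)`, and any jackpot allocation `(1_{A_1},…,1_{A_n})`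
built from a composition with `Σ_i (P(A_i))^{α_i} = (□ h_i)(1)` attains this infimum. -/
theorem power_distortion_constant_risk
    (P : Measure Ω) [IsProbabilityMeasure P] (hP : Atomless P)
    {n : ℕ} (hn : 0 < n)
    (α : Fin n → ℝ) (hα : ∀ i, 1 < α i)
    (h : Fin n → ℝ → ℝ) (hdef : ∀ i x, h i x = x ^ α i) :
    infConvPos P h (fun _ => (1:ℝ)) = ctrInfConvPos P h (fun _ => (1:ℝ)) ∧
    infConvPos P h (fun _ => (1:ℝ)) = ((funInfConv h 1 : ℝ) : EReal) ∧
    ∀ A : Fin n → Set Ω, IsComposition A →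
      (∑ i, ((P (A i)).toReal) ^ α i) = funInfConv h 1 →
      ((∑ i, distortionPos P (h i) ((A i).indicator fun _ => (1:ℝ)) : ℝ) : EReal) =
        infConvPos P h (fun _ => (1:ℝ)) := by
  have hα0 : ∀ i, 0 < α i := fun i => zero_lt_one.trans (hα i)
  have hh : ∀ i, h i = fun x => x ^ α i := fun i => funext (hdef i)
  have hzero : ∀ i, h i 0 = 0 := fun i => by rw [hdef, Real.zero_rpow (hα0 i).ne']
  have hle : infConvPos P h (fun _ => (1:ℝ)) ≤ ctrInfConvPos P h (fun _ => (1:ℝ)) :=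
    sInf_le_sInf fun _ ⟨Xs, hXs, _, hy⟩ => ⟨Xs, hXs, hy⟩
  have hlower : ((funInfConv h 1 : ℝ) : EReal) ≤ infConvPos P h (fun _ => (1:ℝ)) := by
    refine le_sInf ?_
    rintro _ ⟨Xs, ⟨hXs, hsum⟩, rfl⟩
    have hX1 : ∀ i, ∀ᵐ ω ∂P, Xs i ω ≤ 1 := fun i => by
      filter_upwards [hsum] with ω hω
      exact hω ▸ Finset.single_le_sum (fun j _ => (hXs j).2.1 ω) (Finset.mem_univ i)
    have hint : ∀ i, Integrable (Xs i) P := fun i =>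
      .of_bound (hXs i).1.aestronglyMeasurable 1 ((hX1 i).mono fun ω hω => by
        rwa [Real.norm_of_nonneg ((hXs i).2.1 ω)])
    have hmean0 : ∀ i, 0 ≤ ∫ ω, Xs i ω ∂P := fun i => integral_nonneg (hXs i).2.1
    have hmean1 : ∑ i, ∫ ω, Xs i ω ∂P = 1 := by
      rw [← integral_finsetSum _ fun i _ => hint i, integral_congr_ae hsum]
      simp
    rw [EReal.coe_le_coe_iff, funInfConv]
    refine le_trans (csInf_le ⟨0, ?_⟩ ⟨fun i => ∫ ω, Xs i ω ∂P, fun i => ⟨hmean0 i, ?_⟩, hmean1,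
      rfl⟩) (Finset.sum_le_sum fun i _ => ?_)
    · rintro _ ⟨t, ht, -, rfl⟩
      exact Finset.sum_nonneg fun i _ => by
        rw [hdef]
        exact Real.rpow_nonneg (ht i).1 _
    · exact hmean1 ▸ Finset.single_le_sum (fun j _ => hmean0 j) (Finset.mem_univ i)
    · rw [hh]
      exact rpow_integral_le_distortionPos P (hXs i) (hX1 i) (hα i).le
  have hupper : ctrInfConvPos P h (fun _ => (1:ℝ)) ≤ ((funInfConv h 1 : ℝ) : EReal) := by
    obtain ⟨m, rfl⟩ := Nat.exists_eq_succ_of_ne_zero hn.ne'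
    have hattain : ∀ t : Fin (m + 1) → ℝ, (∀ i, t i ∈ Icc (0:ℝ) 1) → ∑ i, t i = 1 →
        ctrInfConvPos P h (fun _ => (1:ℝ)) ≤ ((∑ i, h i (t i) : ℝ) : EReal) := by
      intro t ht hsum
      obtain ⟨A, hAm, hAd, hAu, hAt⟩ := hP.exists_partition t (fun i => (ht i).1)
        MeasurableSet.univ (by rw [hsum, probReal_univ])
      refine sInf_le ⟨_, IsComposition.isAllocPos_indicator ⟨hAm, hAd, hAu⟩ P,
        fun i j hij => counterMonotone_indicator_one P (hAd i j hij), ?_⟩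
      congr 1
      exact Finset.sum_congr rfl fun i _ => by
        rw [distortionPos_indicator_one P (hzero i), ← hAt i, measureReal_def]
    refine not_lt.1 fun hlt => ?_
    obtain ⟨r, hr, hr'⟩ := EReal.lt_iff_exists_real_btwn.1 hlt
    rw [EReal.coe_lt_coe_iff, funInfConv] at hr
    have hsingle : ∀ i, (Pi.single 0 1 : Fin (m + 1) → ℝ) i ∈ Icc (0:ℝ) 1 := fun i => by
      rcases eq_or_ne i 0 with rfl | hi
      · simp
      · simp [hi]
    obtain ⟨_, ⟨t, ht, hsum, rfl⟩, hlt'⟩ :=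
      exists_lt_of_csInf_lt (by exact ⟨_, Pi.single 0 1, hsingle, by simp, rfl⟩) hr
    exact ((hattain t ht hsum).trans_lt (EReal.coe_lt_coe_iff.2 hlt')).not_gt hr'
  have heq : infConvPos P h (fun _ => (1:ℝ)) = ((funInfConv h 1 : ℝ) : EReal) :=
    (hle.trans hupper).antisymm hlower
  refine ⟨hle.antisymm (hupper.trans hlower), heq, fun A _ hA => ?_⟩
  rw [heq, ← hA]
  congr 1
  exact Finset.sum_congr rfl fun i _ => by rw [distortionPos_indicator_one P (hzero i), hdef]
end
end

section
/- Let n ≥ 3 and α_1,…,α_n ∈ (1,∞) with α_1 ≤ α_2 ≤ … ≤ α_n, and set h_i(x) = x^{α_i}. If (A_1,…,A_n) ∈ Π_n satisfies Σ_{i=1}^n (P(A_i))^{α_i} = inf{ Σ_{i=1}^n x_i^{α_i} : x_1,…,x_n ≥ 0, Σ_{i=1}^n x_i = 1 } (that is, (P(A_1),…,P(A_n)) minimizes Σ_i x_i^{α_i} over the probability simplex), then P(A_1) ≤ P(A_2) ≤ … ≤ P(A_n). -/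
open MeasureTheory ProbabilityTheory Set

noncomputable section

variable {Ω : Type*} [MeasurableSpace Ω]

/-- First-order condition for minimizers of `Σ_k x_k ^ α_k` on the simplex: mass can only sit where
the marginal cost is minimal. -/
theorem marginal_le_of_minimizes_sum_rpow {ι : Type*} [Fintype ι] {α x : ι → ℝ}
    (hα : ∀ i, 1 < α i) (hx : ∀ i, 0 ≤ x i) (hsum : ∑ i, x i = 1)
    (hmin : ∀ t : ι → ℝ, (∀ i, 0 ≤ t i) → ∑ i, t i = 1 →
      ∑ i, x i ^ α i ≤ ∑ i, t i ^ α i)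
    {i : ι} (hi : 0 < x i) (j : ι) :
    α i * x i ^ (α i - 1) ≤ α j * x j ^ (α j - 1) := by
  classical
  set v : ι → ℝ := Pi.single j 1 - Pi.single i 1 with hv
  have hderiv : HasDerivAt (fun s : ℝ => ∑ k, (x k + s * v k) ^ α k)
      (∑ k, v k * (α k * x k ^ (α k - 1))) 0 := by
    refine HasDerivAt.fun_sum fun k _ => ?_
    have hline : HasDerivAt (fun s : ℝ => x k + s * v k) (v k) 0 := by
      simpa using ((hasDerivAt_id (0 : ℝ)).mul_const (v k)).const_add (x k)
    simpa [mul_assoc] using hline.rpow_const (p := α k) (Or.inr (hα k).le)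
  have hslope := (hasDerivAt_iff_tendsto_slope.1 hderiv).mono_left
    (nhdsWithin_mono (0 : ℝ) (s := Ioi 0) fun y hy => ne_of_gt hy)
  have hnonneg : 0 ≤ ∑ k, v k * (α k * x k ^ (α k - 1)) := by
    refine ge_of_tendsto hslope ?_
    filter_upwards [Ioo_mem_nhdsGT hi] with s hs
    have hle := hmin (fun k => x k + s * v k) (fun k => ?_) ?_
    · rw [slope_def_field]
      refine div_nonneg ?_ (by linarith [hs.1])
      simpa using hle
    · have hjk : (0 : ℝ) ≤ (Pi.single j 1 : ι → ℝ) k := by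
        by_cases h : k = j
        · subst h; simp
        · simp [h]
      have hxk := hx k
      simp only [hv, Pi.sub_apply]
      by_cases h : k = i
      · subst h
        simp only [Pi.single_eq_same]
        nlinarith [hs.1, hs.2, mul_nonneg hs.1.le hjk]
      · simp only [ne_eq, h, not_false_eq_true, Pi.single_eq_of_ne, sub_zero]
        nlinarith [mul_nonneg hs.1.le hjk]
    · simp [Finset.sum_add_distrib, ← Finset.mul_sum, hv, hsum]
  simp only [hv, Pi.sub_apply, sub_mul, Finset.sum_sub_distrib, Pi.single_apply, ite_mul, one_mul,
    zero_mul, Finset.sum_ite_eq', Finset.mem_univ, if_true] at hnonneg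
  linarith

/-- The derivative of `x ↦ x ^ a` is at most `1` on `[0, 1/3]` for every `a > 1`. -/
theorem mul_rpow_sub_one_le_one {a x : ℝ} (ha : 1 < a) (hx : 0 ≤ x) (hx3 : x ≤ 1 / 3) :
    a * x ^ (a - 1) ≤ 1 := by
  rcases hx.eq_or_lt with rfl | hpos
  · simp [Real.zero_rpow (sub_pos.2 ha).ne']
  · have hlogx : Real.log x ≤ -1 := by
      rw [Real.log_le_iff_le_exp hpos, Real.exp_neg]
      refine hx3.trans ?_
      rw [one_div]
      exact inv_anti₀ (Real.exp_pos 1) (by linarith [Real.exp_one_lt_d9])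
    have hloga := Real.log_le_sub_one_of_pos (zero_lt_one.trans ha)
    rw [← Real.log_nonpos_iff (by positivity), Real.log_mul (by positivity) (by positivity),
      Real.log_rpow hpos]
    nlinarith

/-- Where the derivative of `x ↦ x ^ a` is at most `1`, it decreases as the exponent grows. -/
theorem mul_rpow_sub_one_anti {a b x : ℝ} (ha : 1 < a) (hab : a ≤ b) (hx : 0 < x)
    (hle : a * x ^ (a - 1) ≤ 1) : b * x ^ (b - 1) ≤ a * x ^ (a - 1) := by
  have ha0 : 0 < a := zero_lt_one.trans ha
  have hb0 : 0 < b := ha0.trans_le hab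
  have hlog : Real.log a + (a - 1) * Real.log x ≤ 0 := by
    rwa [← Real.log_nonpos_iff (by positivity), Real.log_mul (by positivity) (by positivity),
      Real.log_rpow hx] at hle
  have hloga := Real.one_sub_inv_le_log_of_pos ha0
  have hlogx : Real.log x ≤ -a⁻¹ := by
    have hinv : 1 - a⁻¹ = (a - 1) * a⁻¹ := by field_simp
    refine le_of_mul_le_mul_left ?_ (sub_pos.2 ha)
    linarith
  have hlogb : Real.log b - Real.log a ≤ (b - a) * a⁻¹ := by
    rw [← Real.log_div hb0.ne' ha0.ne']
    refine (Real.log_le_sub_one_of_pos (by positivity)).trans_eq ?_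
    field_simp
  rw [← Real.log_le_log_iff (by positivity) (by positivity),
    Real.log_mul (by positivity) (by positivity), Real.log_mul (by positivity) (by positivity),
    Real.log_rpow hx, Real.log_rpow hx]
  nlinarith [mul_le_mul_of_nonneg_left hlogx (sub_nonneg.2 hab)]

/-- The measures of the parts of a composition add up to one. -/
theorem IsComposition.sum_toReal_eq_one {P : Measure Ω} [IsProbabilityMeasure P] {n : ℕ}
    {A : Fin n → Set Ω} (hA : IsComposition A) : ∑ i, (P (A i)).toReal = 1 := by
  obtain ⟨hmeas, hdisj, hunion⟩ := hA
  rw [← ENNReal.toReal_sum fun i _ => measure_ne_top P _, ← tsum_fintype (L := .unconditional _),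
    ← measure_iUnion (fun i j hij => disjoint_iff_inter_eq_empty.2 (hdisj i j hij)) hmeas, hunion]
  simp

/-- Proposition 3 (ii). Let `n ≥ 3` and `1 < α_1 ≤ … ≤ α_n`. If the
composition `(A_1,…,A_n)` minimizes `Σ_i x_i^{α_i}` over the probability simplex, i.e.
`Σ_i (P(A_i))^{α_i} = inf { Σ_i x_i^{α_i} : x_i ≥ 0, Σ_i x_i = 1 }`, then
`P(A_1) ≤ P(A_2) ≤ … ≤ P(A_n)`. -/
theorem power_minimizer_monotone
    (P : Measure Ω) [IsProbabilityMeasure P] (hP : Atomless P)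
    {n : ℕ} (hn : 3 ≤ n)
    (α : Fin n → ℝ) (hα : ∀ i, 1 < α i) (hαmono : Monotone α)
    (A : Fin n → Set Ω) (hA : IsComposition A)
    (hopt : ∑ i, ((P (A i)).toReal) ^ α i =
      sInf {y : ℝ | ∃ t : Fin n → ℝ, (∀ i, 0 ≤ t i) ∧ (∑ i, t i) = 1 ∧
        y = ∑ i, (t i) ^ α i}) :
    Monotone fun i => (P (A i)).toReal := by
  have hsum := hA.sum_toReal_eq_one (P := P)
  set x : Fin n → ℝ := fun i => (P (A i)).toReal
  have hx : ∀ i, 0 ≤ x i := fun i => ENNReal.toReal_nonneg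
  have hmin : ∀ t : Fin n → ℝ, (∀ i, 0 ≤ t i) → ∑ i, t i = 1 →
      ∑ i, x i ^ α i ≤ ∑ i, t i ^ α i := by
    intro t ht ht1
    refine hopt.trans_le (csInf_le ⟨0, ?_⟩ ⟨t, ht, ht1, rfl⟩)
    rintro y ⟨u, hu, -, rfl⟩
    exact Finset.sum_nonneg fun i _ => Real.rpow_nonneg (hu i) _
  obtain ⟨k, hk⟩ : ∃ k, x k ≤ 1 / 3 := by
    by_contra! hlt
    have hcard := Finset.sum_lt_sum_of_nonempty (s := (Finset.univ : Finset (Fin n)))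
      ⟨⟨0, by omega⟩, Finset.mem_univ _⟩ fun i _ => hlt i
    have hn' : (3 : ℝ) ≤ n := by exact_mod_cast hn
    rw [show ∑ i, x i = 1 from hsum] at hcard
    simp only [Finset.sum_const, Finset.card_univ, Fintype.card_fin, nsmul_eq_mul] at hcard
    linarith
  intro i j hij
  rcases (hx i).eq_or_lt with hi | hi
  · exact hi.symm.trans_le (hx j)
  have hfoc := marginal_le_of_minimizes_sum_rpow hα hx hsum hmin hi
  have hle := (hfoc k).trans (mul_rpow_sub_one_le_one (hα k) (hx k) hk)
  have hmarg := (mul_rpow_sub_one_anti (hα i) (hαmono hij) hi hle).trans (hfoc j)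
  have hαj := hα j
  exact (Real.rpow_le_rpow_iff (hx i) (hx j) (sub_pos.2 hαj)).1
    (le_of_mul_le_mul_left hmarg (by linarith))
end
end
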